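/- Let A ∈ ℝ^{n×n}, let h ∈ ℝ, let d_0, …, d_{m−1} ∈ ℝ, and let b : ℕ → ℝⁿ satisfy the homogeneous linear recurrence b_{j+m} + Σ_{i=0}^{m−1} d_i b_{j+i} = 0 for all j ∈ ℕ. Let x : ℕ → ℝⁿ be generated by x_{k+1} = x_k − h(Ax_k + b_k), and define the residual y_k = x_{k+m} + Σ_{i=0}^{m−1} d_i x_{k+i}. Then for every k, y_{k+1} = (I − hA) y_k, and consequently y_k = (I − hA)^k y_0. -/

import Mathlib

open Matrix

/-- If the driving signal `b` satisfies the homogeneous recurrence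
`b_{j+m} + Σ_{i<m} d_i b_{j+i} = 0` and `x` is generated by OGD
`x_{k+1} = x_k − h(A x_k + b_k)`, then the residual
`y_k = x_{k+m} + Σ_{i<m} d_i x_{k+i}` satisfies `y_{k+1} = (I − hA) y_k`, and
consequently `y_k = (I − hA)^k y_0`. -/
theorem ogd_residual_recursion (n m : ℕ) (A : Matrix (Fin n) (Fin n) ℝ) (h : ℝ)
    (d : Fin m → ℝ) (b : ℕ → Fin n → ℝ)
    (hb : ∀ j : ℕ, b (j + m) + ∑ i : Fin m, d i • b (j + i) = 0)
    (x : ℕ → Fin n → ℝ)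
    (hx : ∀ k, x (k + 1) = x k - h • (A.mulVec (x k) + b k))
    (y : ℕ → Fin n → ℝ)
    (hy : ∀ k, y k = x (k + m) + ∑ i : Fin m, d i • x (k + i)) :
    (∀ k, y (k + 1) = (1 - h • A).mulVec (y k)) ∧
      ∀ k, y k = ((1 - h • A) ^ k).mulVec (y 0) := by
  have hx' : ∀ k, x (k + 1) = (1 - h • A).mulVec (x k) - h • b k := by
    intro k
    rw [hx, sub_mulVec, one_mulVec, smul_mulVec, smul_add, sub_sub]
  have step : ∀ k, y (k + 1) = (1 - h • A).mulVec (y k) := by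
    intro k
    have hsum : ∑ i : Fin m, d i • x (k + 1 + i) =
        (1 - h • A).mulVec (∑ i : Fin m, d i • x (k + i)) -
          h • ∑ i : Fin m, d i • b (k + i) := by
      rw [mulVec_sum, Finset.smul_sum, ← Finset.sum_sub_distrib]
      refine Finset.sum_congr rfl fun i _ => ?_
      rw [add_right_comm, hx', smul_sub, mulVec_smul, smul_comm h]
    rw [hy (k + 1), hy k, hsum, add_right_comm, hx', mulVec_add, sub_add_sub_comm,
      ← smul_add, hb, smul_zero, sub_zero]
  refine ⟨step, fun k => ?_⟩
  induction k with
  | zero => rw [pow_zero, one_mulVec]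
  | succ k ih => rw [step, ih, mulVec_mulVec, pow_succ']
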